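/- Let (x, p, μ) be a deterministic TFM satisfying weak UIC and 2-weak-SCP, and let b be a bid vector with at least one confirmed bid and universal payment p(b) (the common payment of all confirmed bids). Then every unconfirmed user i satisfies b_i ≤ p(b). -/

import Mathlib

/-- The 1-strict ("weak") utility of a single transaction with true value `v`,
bid `β`, confirmation indicator `conf ∈ {0,1}`, and payment `pay`: a confirmed
transaction yields `v − pay`, while an unconfirmed overbid of amount `β > v`
costs `β − v`. -/
noncomputable def weakUtil (v β conf pay : ℝ) : ℝ :=
  if conf = 1 then v - pay else -(max (β - v) 0)

/-- The joint 1-strict utility of the coalition of the miner and the users in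
`C` (with true values `v`), when the miner mines a block of `n` slots: slot `s`
carries bid `bids s` and is either a real user's transaction
(`owner s = some u`) or a fake transaction of the miner (`owner s = none`,
true value `0`).  The coalition receives the miner revenue, plus the 1-strict
utility of each coalition-owned transaction and of each fake transaction. -/
noncomputable def weakCoalitionUtility
    (x p : (n : ℕ) → (Fin n → ℝ) → Fin n → ℝ)
    (μ : (n : ℕ) → (Fin n → ℝ) → ℝ)
    (m : ℕ) (v : Fin m → ℝ) (C : Finset (Fin m))
    (n : ℕ) (owner : Fin n → Option (Fin m)) (bids : Fin n → ℝ) : ℝ :=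
  μ n bids + ∑ s : Fin n,
    (match owner s with
     | some u => if u ∈ C then weakUtil (v u) (bids s) (x n bids s) (p n bids s)
                 else 0
     | none => weakUtil 0 (bids s) (x n bids s) (p n bids s))

/-- Weak UIC: assuming the miner is honest, truthful bidding maximizes every
individual user's 1-strict utility. -/
def WeakUIC (x p : (n : ℕ) → (Fin n → ℝ) → Fin n → ℝ) : Prop :=
  ∀ (m : ℕ) (b : Fin m → ℝ) (i : Fin m) (r : ℝ),
    weakUtil (b i) r (x m (Function.update b i r) i) (p m (Function.update b i r) i)
      ≤ weakUtil (b i) (b i) (x m b i) (p m b i)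

/-- `c`-weak-SCP: no coalition of the miner and at least one and at most `c`
users can increase its joint 1-strict utility by any deviation — colluding
users bidding untruthfully, the miner injecting fake transactions, or the
miner assembling an arbitrary block (non-coalition users that are included
appear at most once, with their truthful bids). -/
def WeakSCP (c : ℕ)
    (x p : (n : ℕ) → (Fin n → ℝ) → Fin n → ℝ)
    (μ : (n : ℕ) → (Fin n → ℝ) → ℝ) : Prop :=
  ∀ (m : ℕ) (v : Fin m → ℝ) (C : Finset (Fin m)), C.Nonempty → C.card ≤ c →
    ∀ (n : ℕ) (owner : Fin n → Option (Fin m)) (bids : Fin n → ℝ),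
      (∀ s t u, owner s = some u → owner t = some u → s = t) →
      (∀ s u, owner s = some u → u ∉ C → bids s = v u) →
      weakCoalitionUtility x p μ m v C n owner bids
        ≤ weakCoalitionUtility x p μ m v C m (fun s => some s) v

/-- Coalition utility of a block that is a permutation of the users. -/
theorem coalition_perm
    (x p : (n : ℕ) → (Fin n → ℝ) → Fin n → ℝ)
    (μ : (n : ℕ) → (Fin n → ℝ) → ℝ)
    (m : ℕ) (v : Fin m → ℝ) (C : Finset (Fin m)) (e : Equiv.Perm (Fin m))
    (bids : Fin m → ℝ) :
    weakCoalitionUtility x p μ m v C m (fun s => some (e s)) bids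
      = μ m bids + ∑ u ∈ C, weakUtil (v u) (bids (e.symm u))
          (x m bids (e.symm u)) (p m bids (e.symm u)) := by
  unfold weakCoalitionUtility
  congr 1
  rw [← Equiv.sum_comp e.symm]
  simp [Finset.sum_ite_mem]

/-- SCP specialised to blocks that are permutations of the users. -/
theorem scp_perm
    (x p : (n : ℕ) → (Fin n → ℝ) → Fin n → ℝ)
    (μ : (n : ℕ) → (Fin n → ℝ) → ℝ) (hSCP : WeakSCP 2 x p μ)
    (m : ℕ) (v : Fin m → ℝ) (C : Finset (Fin m)) (hC : C.Nonempty) (hc : C.card ≤ 2)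
    (e : Equiv.Perm (Fin m)) (bids : Fin m → ℝ)
    (hb : ∀ s, e s ∉ C → bids s = v (e s)) :
    μ m bids + ∑ u ∈ C, weakUtil (v u) (bids (e.symm u))
          (x m bids (e.symm u)) (p m bids (e.symm u))
      ≤ μ m v + ∑ u ∈ C, weakUtil (v u) (v u) (x m v u) (p m v u) := by
  have h := hSCP m v C hC hc m (fun s => some (e s)) bids
    (by
      intro s t u hs ht
      apply e.injective
      simpa using hs.trans ht.symm)
    (by
      intro s u hs hu
      obtain rfl : e s = u := by simpa using hs
      exact hb s hu)
  have h2 := coalition_perm x p μ m v C (Equiv.refl _) v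
  simp only [Equiv.refl_apply, Equiv.refl_symm] at h2
  rwa [coalition_perm, h2] at h

/-- **Unconfirmed bids are at most the universal payment.**
For a deterministic TFM `(x, p, μ)` satisfying weak UIC and 2-weak-SCP, if some
bid is confirmed under `b` (all confirmed bids pay a common universal price),
then every unconfirmed bid is at most the payment of any confirmed bid. -/
theorem weak_uic_scp_unconfirmed_le_payment
    (x p : (n : ℕ) → (Fin n → ℝ) → Fin n → ℝ)
    (μ : (n : ℕ) → (Fin n → ℝ) → ℝ)
    (hx01 : ∀ n (b : Fin n → ℝ) (i : Fin n), x n b i = 0 ∨ x n b i = 1)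
    (hple : ∀ n (b : Fin n → ℝ) (i : Fin n), x n b i = 1 → p n b i ≤ b i)
    (hp0 : ∀ n (b : Fin n → ℝ) (i : Fin n), x n b i = 0 → p n b i = 0)
    (hμ : ∀ n (b : Fin n → ℝ), 0 ≤ μ n b ∧ μ n b ≤ ∑ i, p n b i)
    (hUIC : WeakUIC x p)
    (hSCP : WeakSCP 2 x p μ) :
    ∀ (m : ℕ) (b : Fin m → ℝ) (i j : Fin m),
      x m b i = 0 → x m b j = 1 → b i ≤ p m b j := by
  intro m b i j hi hj
  by_contra! hlt
  have hij : i ≠ j := by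
    rintro rfl
    rw [hi] at hj
    norm_num at hj
  set b' := Function.update b j (b i) with hb'
  have hb'j : b' j = b i := by simp [hb']
  have hb'i : b' i = b i := by simp [hb', hij]
  have hback : Function.update b' j (b j) = b := by simp [hb']
  -- user `j` stays confirmed and pays the same when bidding `b i`
  have h1 := hUIC m b' j (b j)
  rw [hback, hb'j] at h1
  have h2 := hUIC m b j (b i)
  rw [← hb'] at h2
  have hj' : x m b' j = 1 := by
    rcases hx01 m b' j with h | h
    · simp [weakUtil, h, hj] at h1
      linarith
    · exact h
  simp only [weakUtil, hj, hj', if_true] at h1 h2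
  have hpay : p m b' j = p m b j := by linarith
  -- the miner revenue does not drop
  have h3 := scp_perm x p μ hSCP m b' {j} (by simp) (by simp) (Equiv.refl _) b
    (by
      intro s hs
      have : s ≠ j := by simpa using hs
      simp [hb', this])
  simp only [Finset.sum_singleton, Equiv.refl_symm, Equiv.refl_apply, weakUtil, hj, hj', if_true,
    hpay] at h3
  -- swapping `i` and `j` shows that `i` is confirmed as well
  have h4 := scp_perm x p μ hSCP m b' {i} (by simp) (by simp) (Equiv.swap i j) b'
    (by
      intro s hs
      by_cases hsi : s = i
      · subst hsi
        simp [hb'i, hb'j]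
      by_cases hsj : s = j
      · subst hsj
        simp [hb'i, hb'j]
      rw [Equiv.swap_apply_of_ne_of_ne hsi hsj])
  simp only [Finset.sum_singleton, Equiv.symm_swap, Equiv.swap_apply_left, hb'i, hb'j] at h4
  have hi' : x m b' i = 1 := by
    rcases hx01 m b' i with h | h
    · simp [weakUtil, h, hj', hpay] at h4
      linarith
    · exact h
  simp only [weakUtil, hi', hj', if_true, hpay] at h4
  -- the coalition of the miner, `i` and `j` gains by moving to `b'`
  have h5 := scp_perm x p μ hSCP m b {i, j} (by simp) (Finset.card_le_two) (Equiv.refl _) b'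
    (by
      intro s hs
      have : s ≠ j := by
        rintro rfl
        simp at hs
      simp [hb', this])
  simp [Finset.sum_pair hij, weakUtil, hi', hj', hi, hj, hpay] at h5
  linarith
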